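/- Comparison lemma for square-root differential inequality: if H : [0,∞) → [0,∞) is continuously differentiable and satisfies H'(t) ≤ -ξ(t) H(t) + ζ(t) sqrt(H(t)) for all t ≥ 0, where ξ, ζ are nonnegative continuous functions, then sqrt(H(t)) ≤ sqrt(H(0)) · exp(-(1/2)∫_0^t ξ(τ)dτ) + (1/2)∫_0^t exp((1/2)∫_t^τ ξ(s)ds) ζ(τ) dτ for all t ≥ 0. -/

import Mathlib

open intervalIntegral Real

/-- If `w ≥ 0` satisfies `w' ≤ g √w` on `[0, ∞)` with `g ≥ 0`, then `√w` grows at most at the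
rate `g / 2`, including through zeros of `w`. -/
theorem sqrt_le_sqrt_add_half_integral {w w' g : ℝ → ℝ}
    (hw : ∀ t ≥ 0, 0 ≤ w t) (hderiv : ∀ t ≥ 0, HasDerivAt w (w' t) t)
    (hgc : Continuous g) (hg : ∀ t ≥ 0, 0 ≤ g t)
    (hineq : ∀ t ≥ 0, w' t ≤ g t * √(w t)) {t : ℝ} (ht : 0 ≤ t) :
    √(w t) ≤ √(w 0) + (1 / 2) * ∫ τ in (0 : ℝ)..t, g τ := by
  refine le_of_forall_pos_le_add fun δ hδ => ?_
  have hpos : ∀ s ≥ 0, 0 < w s + δ ^ 2 := fun s hs => by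
    have := hw s hs
    positivity
  have hd : ∀ s ≥ 0, HasDerivAt (fun s => √(w s + δ ^ 2) - (1 / 2) * ∫ τ in (0 : ℝ)..s, g τ)
      (w' s / (2 * √(w s + δ ^ 2)) - (1 / 2) * g s) s := fun s hs =>
    (((hderiv s hs).add_const _).sqrt (hpos s hs).ne').sub
      ((hgc.integral_hasStrictDerivAt 0 s).hasDerivAt.const_mul _)
  have hanti : AntitoneOn (fun s => √(w s + δ ^ 2) - (1 / 2) * ∫ τ in (0 : ℝ)..s, g τ)
      (Set.Ici 0) := by
    refine antitoneOn_of_hasDerivWithinAt_nonpos (convex_Ici 0)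
      (fun s hs => (hd s hs).continuousAt.continuousWithinAt)
      (fun s hs => (hd s (interior_subset hs)).hasDerivWithinAt) fun s hs => ?_
    have hs0 : 0 ≤ s := interior_subset hs
    have hsqrt : √(w s) ≤ √(w s + δ ^ 2) := Real.sqrt_le_sqrt (by nlinarith)
    rw [sub_nonpos, div_le_iff₀ (by have := Real.sqrt_pos.2 (hpos s hs0); positivity)]
    linarith [hineq s hs0, mul_le_mul_of_nonneg_left hsqrt (hg s hs0)]
  have key := hanti (Set.mem_Ici.2 le_rfl) (Set.mem_Ici.2 ht) ht
  simp only [integral_same, mul_zero, sub_zero] at key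
  have h0 : √(w 0 + δ ^ 2) ≤ √(w 0) + δ := by
    rw [Real.sqrt_le_left (by positivity)]
    nlinarith [Real.sq_sqrt (hw 0 le_rfl), Real.sqrt_nonneg (w 0)]
  have h1 : √(w t) ≤ √(w t + δ ^ 2) := Real.sqrt_le_sqrt (by nlinarith)
  linarith

theorem sqrt_comparison_lemma (H H' ξ ζ : ℝ → ℝ)
    (hH : ∀ t ≥ 0, 0 ≤ H t)
    (hderiv : ∀ t ≥ 0, HasDerivAt H (H' t) t)
    (hcont : Continuous H')
    (hξc : Continuous ξ) (hζc : Continuous ζ)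
    (hξ : ∀ t ≥ 0, 0 ≤ ξ t) (hζ : ∀ t ≥ 0, 0 ≤ ζ t)
    (hineq : ∀ t ≥ 0, H' t ≤ -ξ t * H t + ζ t * Real.sqrt (H t)) :
    ∀ t ≥ 0, Real.sqrt (H t) ≤
      Real.sqrt (H 0) * Real.exp (-(1 / 2) * ∫ τ in (0 : ℝ)..t, ξ τ) +
      (1 / 2) * ∫ τ in (0 : ℝ)..t, Real.exp ((1 / 2) * ∫ s in t..τ, ξ s) * ζ τ := by
  intro t ht
  set E : ℝ → ℝ := fun t => Real.exp ((1 / 2) * ∫ τ in (0 : ℝ)..t, ξ τ) with hE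
  have hEpos : ∀ s, 0 < E s := fun s => Real.exp_pos _
  have hEd : ∀ s, HasDerivAt E (E s * ((1 / 2) * ξ s)) s := fun s =>
    ((hξc.integral_hasStrictDerivAt 0 s).hasDerivAt.const_mul _).exp
  have hEc : Continuous E := continuous_iff_continuousAt.2 fun s => (hEd s).continuousAt
  have hsqrt : ∀ s, √(E s ^ 2 * H s) = E s * √(H s) := fun s => by
    rw [Real.sqrt_mul (sq_nonneg _), Real.sqrt_sq (hEpos s).le]
  have key := sqrt_le_sqrt_add_half_integral (w := fun s => E s ^ 2 * H s)
    (w' := fun s => E s ^ 2 * (H' s + ξ s * H s)) (g := fun s => E s * ζ s)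
    (fun s hs => mul_nonneg (sq_nonneg _) (hH s hs))
    (fun s hs => (((hEd s).pow 2).mul (hderiv s hs)).congr_deriv (by
      simp only [Pi.pow_apply]
      push_cast
      ring))
    (hEc.mul hζc) (fun s hs => mul_nonneg (hEpos s).le (hζ s hs))
    (fun s hs => by
      rw [hsqrt]
      have := mul_le_mul_of_nonneg_left (hineq s hs) (sq_nonneg (E s))
      linarith) ht
  simp only [hsqrt] at key
  have hE0 : E 0 = 1 := by simp [hE]
  have hinv : Real.exp (-(1 / 2) * ∫ τ in (0 : ℝ)..t, ξ τ) = (E t)⁻¹ := by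
    rw [hE, ← Real.exp_neg, neg_mul]
  have hratio : ∀ τ, Real.exp ((1 / 2) * ∫ s in t..τ, ξ s) = (E t)⁻¹ * E τ := fun τ => by
    rw [← hinv, hE, ← Real.exp_add, ← integral_interval_sub_left
      (hξc.intervalIntegrable 0 τ) (hξc.intervalIntegrable 0 t)]
    ring_nf
  simp only [hinv, hratio, mul_assoc, integral_const_mul]
  rw [hE0, one_mul, mul_comm (E t), ← le_div_iff₀ (hEpos t)] at key
  exact key.trans_eq (by ring)
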